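/- arXiv:1602.07570 — 3 statements merged into one kernel-verified Lean document; each statement's English description precedes it below -/
import Mathlib

section
/- Monotonicity in information for explorability: in a recommendation game with coupled signals S and S', if S is at least as informative as S', then EX[S'] ⊆ EX[S] for every realization; explicitly, for all s ∈ X and s' ∈ X' with Pr[S=s, S'=s'] > 0, EX_{s'}[S'] ⊆ EX_s[S]. -/
open scoped BigOperators

attribute [local instance] Classical.propDecidable

noncomputable section

namespace BE

variable {n : ℕ} {Θ : Type} {A : Fin n → Type} {X : Type} {X' : Type}

/-- Joint actions: one action per agent. -/
abbrev JA (A : Fin n → Type) : Type := (i : Fin n) → A i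

/-- A realized utility vector: the principal's reward together with each agent's utility. -/
abbrev UVec (n : ℕ) : Type := ℝ × (Fin n → ℝ)

/-- A history: the joint actions chosen and the utility vectors realized so far,
most recent round first. -/
abbrev Hist (A : Fin n → Type) : Type := List (JA A × UVec n)

/-- A (discrete) probability mass function. -/
def IsDPMF {V : Type*} (m : V → ℝ) : Prop :=
  (∀ v, 0 ≤ m v) ∧ HasSum m 1

/-- A prior over the finite state space. -/
def IsPrior [Fintype Θ] (ψ : Θ → ℝ) : Prop :=
  (∀ θ, 0 ≤ ψ θ) ∧ ∑ θ, ψ θ = 1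

/-- Rewards and utilities take values in `[0,1]`. -/
def IsUtil (f : JA A → Θ → ℝ) (u : (i : Fin n) → JA A → Θ → ℝ) : Prop :=
  (∀ a θ, f a θ ∈ Set.Icc (0:ℝ) 1) ∧ ∀ i a θ, u i a θ ∈ Set.Icc (0:ℝ) 1

/-- A stochastic-utility environment `D`: for every joint action `a` and state `θ`,
`D a θ` is a distribution over realized utility vectors supported in `[0,1]^{n+1}`
whose coordinate means are `f a θ` and `u i a θ`. -/
def IsEnv (D : JA A → Θ → UVec n → ℝ) (f : JA A → Θ → ℝ)
    (u : (i : Fin n) → JA A → Θ → ℝ) : Prop :=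
  ∀ a θ, IsDPMF (D a θ) ∧
    (∀ v, D a θ v ≠ 0 → v.1 ∈ Set.Icc (0:ℝ) 1 ∧ ∀ i, v.2 i ∈ Set.Icc (0:ℝ) 1) ∧
    (∑' v : UVec n, D a θ v * v.1) = f a θ ∧
    (∀ i, (∑' v : UVec n, D a θ v * v.2 i) = u i a θ)

/-- The deterministic instance: realized utilities deterministically equal expectations. -/
def detD (f : JA A → Θ → ℝ) (u : (i : Fin n) → JA A → Θ → ℝ) :
    JA A → Θ → UVec n → ℝ :=
  fun a θ v => if v = ((f a θ, fun i => u i a θ) : UVec n) then (1:ℝ) else 0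

/-- An iterative recommendation policy, represented by its per-round conditional
action distributions given the history observed so far. -/
def IsPolicy [∀ i, Fintype (A i)] (P : ℕ → Hist A → JA A → ℝ) : Prop :=
  ∀ t h, (∀ a, 0 ≤ P t h a) ∧ ∑ a : JA A, P t h a = 1

/-- Probability, conditional on the realized state `θ`, of observing history `h`
when all agents follow the recommendations of policy `P` in environment `D`. -/
def histProb (P : ℕ → Hist A → JA A → ℝ) (D : JA A → Θ → UVec n → ℝ) (θ : Θ) :
    Hist A → ℝ
  | [] => 1
  | av :: h => histProb P D θ h * P h.length h av.1 * D av.1 θ av.2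

/-- Conditional (on `θ* = θ`) expectation of `g (aₜ, θ)` in round `t` (0-indexed). -/
def roundCond [∀ i, Fintype (A i)] (P : ℕ → Hist A → JA A → ℝ)
    (D : JA A → Θ → UVec n → ℝ) (θ : Θ) (t : ℕ) (g : JA A → Θ → ℝ) : ℝ :=
  ∑' h : Hist A,
    if h.length = t then histProb P D θ h * ∑ a : JA A, P t h a * g a θ else 0

/-- Expectation of `g (aₜ, θ*)` in round `t` (0-indexed). -/
def roundExp [Fintype Θ] [∀ i, Fintype (A i)] (ψ : Θ → ℝ)
    (P : ℕ → Hist A → JA A → ℝ) (D : JA A → Θ → UVec n → ℝ) (t : ℕ)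
    (g : JA A → Θ → ℝ) : ℝ :=
  ∑ θ, ψ θ * roundCond P D θ t g

/-- Conditional (on `θ* = θ`) probability that policy `P` plays the joint action `a`
in round `t` (0-indexed). -/
def probAt [∀ i, Fintype (A i)] (P : ℕ → Hist A → JA A → ℝ)
    (D : JA A → Θ → UVec n → ℝ) (θ : Θ) (t : ℕ) (a : JA A) : ℝ :=
  ∑' h : Hist A, if h.length = t then histProb P D θ h * P t h a else 0

/-- δ-Bayesian incentive-compatibility at round `t` (0-indexed), stated in the
equivalent indicator-weighted (unconditional) form: for every agent `i` and actions
`ai, ai'`, the expected gain of following the recommendation `ai` over deviating to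
`ai'` (weighted by the event of being recommended `ai`) is at least `δ` times the
probability of being recommended `ai`. -/
def BICAt [Fintype Θ] [∀ i, Fintype (A i)] (ψ : Θ → ℝ)
    (P : ℕ → Hist A → JA A → ℝ) (D : JA A → Θ → UVec n → ℝ)
    (u : (i : Fin n) → JA A → Θ → ℝ) (δ : ℝ) (t : ℕ) : Prop :=
  ∀ (i : Fin n) (ai ai' : A i),
    δ * roundExp ψ P D t (fun a _ => if a i = ai then 1 else 0) ≤
      roundExp ψ P D t
        (fun a θ => if a i = ai then u i a θ - u i (Function.update a i ai') θ else 0)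

/-- δ-BIC iterative recommendation policy (`δ = 0` is plain BIC). -/
def IsBIC [Fintype Θ] [∀ i, Fintype (A i)] (ψ : Θ → ℝ)
    (P : ℕ → Hist A → JA A → ℝ) (D : JA A → Θ → UVec n → ℝ)
    (u : (i : Fin n) → JA A → Θ → ℝ) (δ : ℝ) : Prop :=
  IsPolicy P ∧ ∀ t, BICAt ψ P D u δ t

/-- Cumulative expected reward over the first `T` rounds. -/
def REW [Fintype Θ] [∀ i, Fintype (A i)] (ψ : Θ → ℝ)
    (P : ℕ → Hist A → JA A → ℝ) (D : JA A → Θ → UVec n → ℝ)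
    (f : JA A → Θ → ℝ) (T : ℕ) : ℝ :=
  ∑ t ∈ Finset.range T, roundExp ψ P D t f

/-- The one-round benchmark `OPT` over a class `C` of policies. -/
def OPT [Fintype Θ] [∀ i, Fintype (A i)] (ψ : Θ → ℝ)
    (D : JA A → Θ → UVec n → ℝ) (f : JA A → Θ → ℝ)
    (C : (ℕ → Hist A → JA A → ℝ) → Prop) : ℝ :=
  sSup {r : ℝ | ∃ P, C P ∧ ∃ t : ℕ, r = roundExp ψ P D t f}

/-- A signal structure: the conditional distribution of the signal given the state. -/
def IsSigKernel (q : Θ → X → ℝ) : Prop :=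
  ∀ θ, (∀ s, 0 ≤ q θ s) ∧ HasSum (q θ) 1

/-- LP-representation of a recommendation policy in the recommendation game. -/
def IsRecPolicy [∀ i, Fintype (A i)] (x : JA A → X → ℝ) : Prop :=
  (∀ a s, 0 ≤ x a s) ∧ ∀ s, ∑ a : JA A, x a s = 1

/-- Membership in the polytope of δ-BIC recommendation policies (`δ = 0` is `BIC[S]`). -/
def InBIC [Fintype Θ] [∀ i, Fintype (A i)] (ψ : Θ → ℝ) (q : Θ → X → ℝ)
    (u : (i : Fin n) → JA A → Θ → ℝ) (δ : ℝ) (x : JA A → X → ℝ) : Prop :=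
  IsRecPolicy x ∧ ∀ (i : Fin n) (ai ai' : A i),
    δ * (∑ θ, ψ θ * ∑' s : X, q θ s * ∑ a : JA A, (if a i = ai then x a s else 0)) ≤
      ∑ θ, ψ θ * ∑' s : X, q θ s *
        ∑ a : JA A,
          (if a i = ai then (u i a θ - u i (Function.update a i ai') θ) * x a s else 0)

/-- Expected reward of a recommendation policy `x`, with reward function `f`. -/
def recREW [Fintype Θ] [∀ i, Fintype (A i)] (ψ : Θ → ℝ) (q : Θ → X → ℝ)
    (f : JA A → Θ → ℝ) (x : JA A → X → ℝ) : ℝ :=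
  ∑ θ, ψ θ * ∑' s : X, q θ s * ∑ a : JA A, x a s * f a θ

/-- `REW*[S]`: the optimal expected reward over δ-BIC recommendation policies. -/
def REWstar [Fintype Θ] [∀ i, Fintype (A i)] (ψ : Θ → ℝ) (q : Θ → X → ℝ)
    (f : JA A → Θ → ℝ) (u : (i : Fin n) → JA A → Θ → ℝ) (δ : ℝ) : ℝ :=
  sSup {r : ℝ | ∃ x : JA A → X → ℝ, InBIC ψ q u δ x ∧ r = recREW ψ q f x}

/-- `EX_s[S]`: the signal-explorable joint actions at the feasible signal `s`. -/
def EXs [Fintype Θ] [∀ i, Fintype (A i)] (ψ : Θ → ℝ) (q : Θ → X → ℝ)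
    (u : (i : Fin n) → JA A → Θ → ℝ) (s : X) : Set (JA A) :=
  {a | ∃ x : JA A → X → ℝ, InBIC ψ q u 0 x ∧ 0 < x a s}

/-- Value type of the `AllInfo` signal. -/
abbrev AIVal (A : Fin n → Type) : Type := Finset (JA A) × (JA A → UVec n)

/-- The realization, at state `θ`, of the signal `AllInfo(B)`: the set `B θ` together
with the rewards/utilities of all joint actions in `B θ`. -/
def allInfoVal [∀ i, Fintype (A i)] (B : Θ → Finset (JA A)) (f : JA A → Θ → ℝ)
    (u : (i : Fin n) → JA A → Θ → ℝ) (θ : Θ) : AIVal A :=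
  (B θ, fun a => if a ∈ B θ then ((f a θ, fun i => u i a θ) : UVec n)
                 else (((0:ℝ), fun _ => (0:ℝ)) : UVec n))

/-- The signal kernel of `AllInfo(B)`. -/
def qAI [∀ i, Fintype (A i)] (B : Θ → Finset (JA A)) (f : JA A → Θ → ℝ)
    (u : (i : Fin n) → JA A → Θ → ℝ) : Θ → AIVal A → ℝ :=
  fun θ v => if v = allInfoVal B f u θ then (1:ℝ) else 0

/-- The set of δ-eventually-explorable joint actions given the state `θ`, for the
environment `D`: actions played with positive probability in some round by some
δ-BIC iterative recommendation policy. -/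
def explSet [Fintype Θ] [∀ i, Fintype (A i)] (ψ : Θ → ℝ)
    (D : JA A → Θ → UVec n → ℝ) (u : (i : Fin n) → JA A → Θ → ℝ) (δ : ℝ)
    (θ : Θ) : Finset (JA A) :=
  (Set.toFinite {a : JA A | ∃ P, IsBIC ψ P D u δ ∧ ∃ t, 0 < probAt P D θ t a}).toFinset


/-- Marginal kernel of the first signal `S` in a coupling `j` of two signals. -/
def margS {Θ : Type} {X : Type} {X' : Type} (j : Θ → X → X' → ℝ) : Θ → X → ℝ :=
  fun θ s => ∑' s' : X', j θ s s'

/-- Marginal kernel of the second signal `S'` in a coupling `j` of two signals. -/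
def margS' {Θ : Type} {X : Type} {X' : Type} (j : Θ → X → X' → ℝ) : Θ → X' → ℝ :=
  fun θ s' => ∑' s : X, j θ s s'

/-- A coupling of two signals: given the state, a joint distribution over `X × X'`. -/
def IsJointKernel {Θ : Type} {X : Type} {X' : Type} (j : Θ → X → X' → ℝ) : Prop :=
  ∀ θ, (∀ s s', 0 ≤ j θ s s') ∧ HasSum (fun p : X × X' => j θ p.1 p.2) 1

/-- `S` is at least as informative as `S'`:
`Pr[θ* = θ | S = s, S' = s'] = Pr[θ* = θ | S = s]` whenever `Pr[S = s, S' = s'] > 0`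
(stated in cross-multiplied form). -/
def MoreInformative {Θ : Type} {X : Type} {X' : Type} [Fintype Θ]
    (ψ : Θ → ℝ) (j : Θ → X → X' → ℝ) : Prop :=
  ∀ (θ : Θ) (s : X) (s' : X'), 0 < ∑ τ, ψ τ * j τ s s' →
    (ψ θ * j θ s s') * (∑ τ, ψ τ * margS j τ s)
      = (ψ θ * margS j θ s) * (∑ τ, ψ τ * j τ s s')

/-- If `S` is at least as informative as `S'`, then `S'` is a garbling of `S`: there is a
stochastic kernel `w` from `X` to `X'`, positive on jointly feasible pairs, which recovers the
joint distribution from the marginal of `S`. -/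
theorem MoreInformative.exists_garbling {Θ X X' : Type} [Fintype Θ] {ψ : Θ → ℝ}
    {j : Θ → X → X' → ℝ} (hψ : ∀ θ, 0 ≤ ψ θ) (hj : IsJointKernel j)
    (hMI : MoreInformative ψ j) (s'₀ : X') :
    ∃ w : X → X' → ℝ, (∀ s s', 0 ≤ w s s') ∧ (∀ s, HasSum (w s) 1) ∧
      (∀ θ s s', ψ θ * margS j θ s * w s s' = ψ θ * j θ s s') ∧
      ∀ s s', 0 < ∑ τ, ψ τ * j τ s s' → 0 < w s s' := by
  set p : X → X' → ℝ := fun s s' => ∑ τ, ψ τ * j τ s s' with hp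
  set m : X → ℝ := fun s => ∑ τ, ψ τ * margS j τ s with hm
  have hterm : ∀ τ s s', 0 ≤ ψ τ * j τ s s' := fun τ s s' => mul_nonneg (hψ τ) ((hj τ).1 s s')
  have hp0 : ∀ s s', 0 ≤ p s s' := fun s s' => Finset.sum_nonneg fun τ _ => hterm τ s s'
  have hle : ∀ θ s s', ψ θ * j θ s s' ≤ p s s' := fun θ s s' =>
    Finset.single_le_sum (f := fun τ => ψ τ * j τ s s') (fun τ _ => hterm τ s s')
      (Finset.mem_univ θ)
  have hj_sum : ∀ θ s, HasSum (j θ s) (margS j θ s) := fun θ s =>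
    ((hj θ).2.summable.prod_factor s).hasSum
  have hmarg0 : ∀ θ s, 0 ≤ ψ θ * margS j θ s := fun θ s =>
    mul_nonneg (hψ θ) (tsum_nonneg fun s' => (hj θ).1 s s')
  have hp_sum : ∀ s, HasSum (p s) (m s) := fun s =>
    hasSum_sum fun θ _ => (hj_sum θ s).mul_left (ψ θ)
  have hm0 : ∀ s, 0 ≤ m s := fun s => Finset.sum_nonneg fun τ _ => hmarg0 τ s
  have hpm : ∀ s s', p s s' ≤ m s := fun s s' =>
    le_hasSum (hp_sum s) s' fun t _ => hp0 s t
  refine ⟨fun s s' => if m s = 0 then (if s' = s'₀ then 1 else 0) else p s s' / m s,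
    fun s s' => ?_, fun s => ?_, fun θ s s' => ?_, fun s s' h => ?_⟩
  · dsimp only
    split_ifs
    · exact zero_le_one
    · exact le_rfl
    · exact div_nonneg (hp0 s s') (hm0 s)
  · by_cases h : m s = 0
    · simpa only [h, if_true] using hasSum_ite_eq s'₀ (1 : ℝ)
    · simpa only [h, if_false, div_self h] using (hp_sum s).div_const (m s)
  · by_cases h : m s = 0
    · have h1 : ψ θ * margS j θ s = 0 :=
        (Finset.sum_eq_zero_iff_of_nonneg fun τ _ => hmarg0 τ s).1 h θ (Finset.mem_univ θ)
      have h2 : ψ θ * j θ s s' = 0 :=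
        le_antisymm ((hle θ s s').trans ((hpm s s').trans h.le)) (hterm θ s s')
      rw [h1, h2, zero_mul]
    · simp only [h, if_false]
      rw [← mul_div_assoc, div_eq_iff h]
      rcases (hp0 s s').eq_or_lt with h0 | hpos
      · have h2 : ψ θ * j θ s s' = 0 := le_antisymm ((hle θ s s').trans h0.ge) (hterm θ s s')
        rw [h2, ← h0, mul_zero, zero_mul]
      · exact (hMI θ s s' hpos).symm
  · have hms : 0 < m s := lt_of_lt_of_le h (hpm s s')
    simp only [hms.ne', if_false]
    exact div_pos h hms

/-- A recommendation policy takes values at most `1`. -/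
theorem IsRecPolicy.le_one {n : ℕ} {A : Fin n → Type} {X : Type} [∀ i, Fintype (A i)]
    {x : JA A → X → ℝ} (hx : IsRecPolicy x) (a : JA A) (s : X) : x a s ≤ 1 :=
  (Finset.single_le_sum (f := fun b => x b s) (fun b _ => hx.1 b s)
    (Finset.mem_univ a)).trans_eq (hx.2 s)

/-- Averaging a recommendation policy against a stochastic kernel converges. -/
theorem IsRecPolicy.summable_mul {n : ℕ} {A : Fin n → Type} {X' : Type}
    [∀ i, Fintype (A i)] {x' : JA A → X' → ℝ} (hx' : IsRecPolicy x') {v : X' → ℝ}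
    (hv0 : ∀ s', 0 ≤ v s') (hv : Summable v) (a : JA A) :
    Summable fun s' => v s' * x' a s' :=
  hv.of_nonneg_of_le (fun s' => mul_nonneg (hv0 s') (hx'.1 a s'))
    fun s' => mul_le_of_le_one_right (hv0 s') (hx'.le_one a s')

/-- Averaging a recommendation policy against a stochastic kernel is a recommendation policy. -/
theorem IsRecPolicy.garble {n : ℕ} {A : Fin n → Type} {X X' : Type} [∀ i, Fintype (A i)]
    {x' : JA A → X' → ℝ} (hx' : IsRecPolicy x') {w : X → X' → ℝ}
    (hw0 : ∀ s s', 0 ≤ w s s') (hw : ∀ s, HasSum (w s) 1) :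
    IsRecPolicy fun a s => ∑' s', w s s' * x' a s' := by
  refine ⟨fun a s => tsum_nonneg fun s' => mul_nonneg (hw0 s s') (hx'.1 a s'), fun s => ?_⟩
  rw [← Summable.tsum_finsetSum fun a _ => hx'.summable_mul (hw0 s) (hw s).summable a]
  simp only [← Finset.mul_sum, hx'.2, mul_one, (hw s).tsum_eq]

/-- Averaging a recommendation policy for `S'` against a garbling kernel preserves
the conditional expectation of every payoff. -/
theorem IsRecPolicy.tsum_garble {n : ℕ} {Θ : Type} {A : Fin n → Type} {X X' : Type}
    [∀ i, Fintype (A i)] {x' : JA A → X' → ℝ} (hx' : IsRecPolicy x')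
    {ψ : Θ → ℝ} {j : Θ → X → X' → ℝ} (hj : IsJointKernel j) {w : X → X' → ℝ}
    (hw0 : ∀ s s', 0 ≤ w s s') (hw : ∀ s, HasSum (w s) 1)
    (hwj : ∀ θ s s', ψ θ * margS j θ s * w s s' = ψ θ * j θ s s') (θ : Θ) (c : JA A → ℝ) :
    ψ θ * ∑' s, margS j θ s * ∑ a, c a * ∑' s', w s s' * x' a s' =
      ψ θ * ∑' s', margS' j θ s' * ∑ a, c a * x' a s' := by
  set g : X' → ℝ := fun s' => ∑ a, c a * x' a s' with hg
  have hgle : ∀ s', |g s'| ≤ ∑ a, |c a| := fun s' =>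
    (Finset.abs_sum_le_sum_abs _ _).trans <| Finset.sum_le_sum fun a _ => by
      rw [abs_mul, abs_of_nonneg (hx'.1 a s')]
      exact mul_le_of_le_one_right (abs_nonneg _) (hx'.le_one a s')
  have hsum : Summable (Function.uncurry fun (s : X) (s' : X') => j θ s s' * g s') := by
    refine Summable.of_norm_bounded ((hj θ).2.summable.mul_right (∑ a, |c a|)) fun q => ?_
    rw [Function.uncurry, Real.norm_eq_abs, abs_mul, abs_of_nonneg ((hj θ).1 _ _)]
    exact mul_le_mul_of_nonneg_left (hgle _) ((hj θ).1 _ _)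
  have hinner : ∀ s, ∑ a, c a * ∑' s', w s s' * x' a s' = ∑' s', w s s' * g s' := fun s => by
    simp only [← tsum_mul_left]
    rw [← Summable.tsum_finsetSum fun a _ =>
      (hx'.summable_mul (hw0 s) (hw s).summable a).mul_left (c a)]
    simp only [hg, Finset.mul_sum, mul_left_comm]
  calc ψ θ * ∑' s, margS j θ s * ∑ a, c a * ∑' s', w s s' * x' a s'
      = ∑' s, ∑' s', ψ θ * (j θ s s' * g s') := by
        simp only [hinner]
        simp only [← tsum_mul_left, ← mul_assoc, hwj]
    _ = ψ θ * ∑' s', ∑' s, j θ s s' * g s' := by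
        simp only [tsum_mul_left]
        rw [hsum.tsum_comm]
    _ = ψ θ * ∑' s', margS' j θ s' * g s' := by simp only [tsum_mul_right, margS']

/-- monotonicity in information for explorability. In a recommendation
game with coupled signals `S, S'` (joint kernel `j`), if `S` is at least as
informative as `S'`, then for all realizations `s, s'` with `Pr[S = s, S' = s'] > 0`
we have `EX_{s'}[S'] ⊆ EX_s[S]`. -/
theorem monotonicity_in_information_explorability
    {n : ℕ} {Θ : Type} {A : Fin n → Type} {X : Type} {X' : Type}
    [Fintype Θ] [∀ i, Fintype (A i)]
    (ψ : Θ → ℝ) (f : JA A → Θ → ℝ) (u : (i : Fin n) → JA A → Θ → ℝ)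
    (j : Θ → X → X' → ℝ)
    (hψ : IsPrior ψ) (hu : IsUtil f u) (hj : IsJointKernel j)
    (hMI : MoreInformative ψ j) :
    ∀ (s : X) (s' : X'), 0 < ∑ τ, ψ τ * j τ s s' →
      EXs ψ (margS' j) u s' ⊆ EXs ψ (margS j) u s := by
  rintro s s' hpos a ⟨x', ⟨hx', hbic⟩, hxa⟩
  obtain ⟨w, hw0, hw, hwj, hwpos⟩ := hMI.exists_garbling hψ.1 hj s'
  refine ⟨fun a s => ∑' s', w s s' * x' a s', ⟨hx'.garble hw0 hw, fun i ai ai' => ?_⟩, ?_⟩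
  · have h := hbic i ai ai'
    rw [zero_mul] at h ⊢
    refine h.trans_eq (Finset.sum_congr rfl fun θ _ => ?_)
    have key := hx'.tsum_garble hj hw0 hw hwj θ
      fun a => if a i = ai then u i a θ - u i (Function.update a i ai') θ else 0
    simp only [ite_mul, zero_mul] at key
    exact key.symm
  · exact (hx'.summable_mul (hw0 s) (hw s).summable a).tsum_pos
      (fun t => mul_nonneg (hw0 s t) (hx'.1 a t)) s' (mul_pos (hwpos s s' hpos) hxa)

end BE

end
end

section
/- Consider Bayesian Exploration with deterministic utilities. Let σ be a maximally-exploring subroutine of duration T_σ, i.e., a BIC subroutine with empty input signal that, with probability 1, explores every joint action in A^det_{θ*} by the time it stops. Let π* be an optimal BIC recommendation policy for the signal AllInfo(A^det_{θ*}), and let π be the composition of σ followed by T − T_σ copies of π*. Then π is a BIC iterative recommendation policy and REW(π) ≥ (T − T_σ)·OPT(Π_BIC). -/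
open scoped BigOperators

attribute [local instance] Classical.propDecidable

noncomputable section

namespace BE

variable {n : ℕ} {Θ : Type} {A : Fin n → Type} {X : Type} {X' : Type}

section Deterministic

variable {P Q : ℕ → Hist A → JA A → ℝ} {f : JA A → Θ → ℝ}
  {u : (i : Fin n) → JA A → Θ → ℝ}

lemma histProb_congr {m : ℕ} {D : JA A → Θ → UVec n → ℝ}
    (hPQ : ∀ t h a, t < m → P t h a = Q t h a) (θ : Θ) {h : Hist A} (hh : h.length ≤ m) :
    histProb P D θ h = histProb Q D θ h := by
  induction h with
  | nil => rfl
  | cons av h ih =>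
    rw [List.length_cons] at hh
    simp only [histProb]
    rw [ih (by omega), hPQ _ _ _ (by omega)]

lemma histProb_drop_ne_zero {D : JA A → Θ → UVec n → ℝ} {θ : Θ} {h : Hist A}
    (hh : histProb P D θ h ≠ 0) (k : ℕ) : histProb P D θ (h.drop k) ≠ 0 := by
  induction h generalizing k with
  | nil => simpa using hh
  | cons av h ih =>
    cases k with
    | zero => simpa using hh
    | succ k => exact ih (left_ne_zero_of_mul (left_ne_zero_of_mul hh)) k

variable [∀ i, Fintype (A i)]

/-- The finite set of length-`t` histories that are consistent with the state `θ`. -/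
def detHist (f : JA A → Θ → ℝ) (u : (i : Fin n) → JA A → Θ → ℝ) (θ : Θ) :
    ℕ → Finset (Hist A)
  | 0 => {[]}
  | t + 1 => (Finset.univ ×ˢ detHist f u θ t).image
      fun p => (p.1, ((f p.1 θ, fun i => u i p.1 θ) : UVec n)) :: p.2

lemma length_of_mem_detHist {θ : Θ} {t : ℕ} {h : Hist A} (hh : h ∈ detHist f u θ t) :
    h.length = t := by
  induction t generalizing h with
  | zero => simp_all [detHist]
  | succ t ih =>
    simp only [detHist, Finset.mem_image, Finset.mem_product, Finset.mem_univ, true_and] at hh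
    obtain ⟨p, hp, rfl⟩ := hh
    simp [ih hp]

lemma mem_detHist_of_histProb_ne_zero {θ : Θ} {h : Hist A}
    (hh : histProb P (detD f u) θ h ≠ 0) : h ∈ detHist f u θ h.length := by
  induction h with
  | nil => simp [detHist]
  | cons av h ih =>
    obtain ⟨a, v⟩ := av
    simp only [histProb, mul_ne_zero_iff, detD, ne_eq, ite_eq_right_iff, one_ne_zero,
      imp_false, not_not] at hh
    obtain ⟨⟨h₁, -⟩, h₂⟩ := hh
    simp only [detHist, List.length_cons, Finset.mem_image, Finset.mem_product,
      Finset.mem_univ, true_and]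
    exact ⟨(a, h), ih h₁, by rw [h₂]⟩

lemma tsum_hist_eq_sum (P : ℕ → Hist A → JA A → ℝ) (θ : Θ) (t : ℕ) (φ : Hist A → ℝ) :
    (∑' h : Hist A, if h.length = t then histProb P (detD f u) θ h * φ h else 0) =
      ∑ h ∈ detHist f u θ t, histProb P (detD f u) θ h * φ h := by
  rw [tsum_eq_sum (s := detHist f u θ t)]
  · exact Finset.sum_congr rfl fun h hh => if_pos (length_of_mem_detHist hh)
  · intro h hh
    split_ifs with hl
    · subst hl
      have h₀ : histProb P (detD f u) θ h = 0 := by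
        by_contra hne
        exact hh (mem_detHist_of_histProb_ne_zero hne)
      rw [h₀, zero_mul]
    · rfl

lemma histProb_nonneg (hP : IsPolicy P) (θ : Θ) (h : Hist A) :
    0 ≤ histProb P (detD f u) θ h := by
  induction h with
  | nil => simp [histProb]
  | cons av h ih =>
    refine mul_nonneg (mul_nonneg ih ((hP _ _).1 _)) ?_
    unfold detD
    split_ifs <;> norm_num

lemma sum_histProb (hP : IsPolicy P) (θ : Θ) (t : ℕ) :
    ∑ h ∈ detHist f u θ t, histProb P (detD f u) θ h = 1 := by
  induction t with
  | zero => simp [detHist, histProb]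
  | succ t ih =>
    rw [detHist, Finset.sum_image, Finset.sum_product_right, ← ih]
    · refine Finset.sum_congr rfl fun h _ => ?_
      simp only [histProb, detD, if_true, mul_one]
      rw [← Finset.mul_sum, (hP _ _).2, mul_one]
    · rintro ⟨a, h⟩ - ⟨b, k⟩ - hab
      simp only [List.cons.injEq, Prod.mk.injEq] at hab
      exact Prod.ext hab.1.1 hab.2

lemma roundCond_congr {m : ℕ} {D : JA A → Θ → UVec n → ℝ}
    (hPQ : ∀ t h a, t < m → P t h a = Q t h a) (θ : Θ) {t : ℕ} (ht : t < m)
    (G : JA A → Θ → ℝ) : roundCond P D θ t G = roundCond Q D θ t G := by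
  refine tsum_congr fun h => ?_
  split_ifs with hl
  · rw [histProb_congr hPQ θ (by omega)]
    simp only [hPQ _ _ _ ht]
  · rfl

lemma probAt_pos (hP : IsPolicy P) {θ : Θ} {h : Hist A} {a : JA A}
    (hh : histProb P (detD f u) θ h ≠ 0) (ha : P h.length h a ≠ 0) :
    0 < probAt P (detD f u) θ h.length a := by
  rw [probAt, tsum_hist_eq_sum P θ h.length fun h' => P h.length h' a]
  have hnn : ∀ k ∈ detHist f u θ h.length,
      0 ≤ histProb P (detD f u) θ k * P h.length k a :=
    fun k _ => mul_nonneg (histProb_nonneg hP θ k) ((hP _ _).1 _)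
  have hmem := mem_detHist_of_histProb_ne_zero hh
  exact ((hnn h hmem).lt_of_ne' (mul_ne_zero hh ha)).trans_le
    (Finset.single_le_sum hnn hmem)

lemma probAt_nonneg (hP : IsPolicy P) (θ : Θ) (t : ℕ) (a : JA A) :
    0 ≤ probAt P (detD f u) θ t a := by
  rw [probAt, tsum_hist_eq_sum P θ t fun h => P t h a]
  exact Finset.sum_nonneg fun h _ => mul_nonneg (histProb_nonneg hP θ h) ((hP _ _).1 _)

lemma roundCond_eq_sum_probAt (P : ℕ → Hist A → JA A → ℝ) (θ : Θ) (t : ℕ)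
    (G : JA A → Θ → ℝ) :
    roundCond P (detD f u) θ t G = ∑ a : JA A, probAt P (detD f u) θ t a * G a θ := by
  rw [roundCond, tsum_hist_eq_sum P θ t fun h => ∑ a : JA A, P t h a * G a θ]
  have hp : ∀ a, probAt P (detD f u) θ t a =
      ∑ h ∈ detHist f u θ t, histProb P (detD f u) θ h * P t h a :=
    fun a => tsum_hist_eq_sum P θ t fun h => P t h a
  simp only [hp, Finset.mul_sum, Finset.sum_mul, mul_assoc]
  exact Finset.sum_comm

lemma sum_probAt (hP : IsPolicy P) (θ : Θ) (t : ℕ) :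
    ∑ a : JA A, probAt P (detD f u) θ t a = 1 := by
  have h := roundCond_eq_sum_probAt (f := f) (u := u) P θ t fun _ _ => 1
  simp only [mul_one] at h
  rw [← h, roundCond, tsum_hist_eq_sum P θ t fun h => ∑ a : JA A, P t h a * 1]
  simp only [mul_one, (hP _ _).2, sum_histProb hP]

lemma roundCond_nonneg (hP : IsPolicy P) {θ : Θ} {t : ℕ} {G : JA A → Θ → ℝ}
    (hG : ∀ a, 0 ≤ G a θ) : 0 ≤ roundCond P (detD f u) θ t G := by
  rw [roundCond_eq_sum_probAt]
  exact Finset.sum_nonneg fun a _ => mul_nonneg (probAt_nonneg hP θ t a) (hG a)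

lemma eq_of_allInfoVal_eq {B : Θ → Finset (JA A)} {θ θ' : Θ}
    (h : allInfoVal B f u θ = allInfoVal B f u θ') {a : JA A} (ha : a ∈ B θ) :
    ((f a θ, fun i => u i a θ) : UVec n) = (f a θ', fun i => u i a θ') := by
  have h₁ : B θ = B θ' := congrArg Prod.fst h
  have h₂ := congrFun (congrArg Prod.snd h) a
  simpa only [allInfoVal, if_pos ha, if_pos (h₁ ▸ ha)] using h₂

lemma tsum_qAI (B : Θ → Finset (JA A)) (θ : Θ) (F : AIVal A → ℝ) :
    ∑' s, qAI B f u θ s * F s = F (allInfoVal B f u θ) := by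
  rw [tsum_eq_single (allInfoVal B f u θ)]
  · simp [qAI]
  · intro s hs
    simp [qAI, hs]

variable [Fintype Θ] {ψ : Θ → ℝ}

/-- Under a BIC policy, histories are equally likely in states that cannot be told apart by
the eventually-explorable actions. -/
lemma histProb_eq_of_allInfoVal_eq (hP : IsBIC ψ P (detD f u) u 0) {θ θ' : Θ}
    (hθ : allInfoVal (explSet ψ (detD f u) u 0) f u θ =
      allInfoVal (explSet ψ (detD f u) u 0) f u θ') (h : Hist A) :
    histProb P (detD f u) θ h = histProb P (detD f u) θ' h := by
  induction h with
  | nil => rfl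
  | cons av h ih =>
    simp only [histProb]
    rw [← ih]
    by_cases h₁ : histProb P (detD f u) θ h = 0
    · simp [h₁]
    by_cases h₂ : P h.length h av.1 = 0
    · simp [h₂]
    have hmem : av.1 ∈ explSet ψ (detD f u) u 0 θ := by
      rw [explSet, Set.Finite.mem_toFinset]
      exact ⟨P, hP, h.length, probAt_pos hP.1 h₁ h₂⟩
    simp only [detD, eq_of_allInfoVal_eq hθ hmem]

lemma probAt_eq_of_allInfoVal_eq (hP : IsBIC ψ P (detD f u) u 0) {θ θ' : Θ}
    (hθ : allInfoVal (explSet ψ (detD f u) u 0) f u θ =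
      allInfoVal (explSet ψ (detD f u) u 0) f u θ') (t : ℕ) (a : JA A) :
    probAt P (detD f u) θ t a = probAt P (detD f u) θ' t a := by
  simp only [probAt, histProb_eq_of_allInfoVal_eq hP hθ]

/-- A recommendation policy for `AllInfo(B)` replicates round `t` of the iterative policy `P`
if in every possible state it induces the same distribution over joint actions. -/
def Replicates (ψ : Θ → ℝ) (f : JA A → Θ → ℝ) (u : (i : Fin n) → JA A → Θ → ℝ)
    (B : Θ → Finset (JA A)) (P : ℕ → Hist A → JA A → ℝ) (t : ℕ)
    (z : JA A → AIVal A → ℝ) : Prop :=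
  ∀ θ, 0 < ψ θ → ∀ G : JA A → Θ → ℝ,
    roundCond P (detD f u) θ t G = ∑ a : JA A, z a (allInfoVal B f u θ) * G a θ

variable {B : Θ → Finset (JA A)} {t : ℕ} {z : JA A → AIVal A → ℝ}

lemma Replicates.roundExp_eq (hψ : IsPrior ψ) (hz : Replicates ψ f u B P t z)
    (G : JA A → Θ → ℝ) :
    roundExp ψ P (detD f u) t G =
      ∑ θ, ψ θ * ∑' s, qAI B f u θ s * ∑ a : JA A, z a s * G a θ := by
  refine Finset.sum_congr rfl fun θ _ => ?_
  rw [tsum_qAI B θ fun s => ∑ a : JA A, z a s * G a θ]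
  rcases (hψ.1 θ).eq_or_lt with h | h
  · rw [← h, zero_mul, zero_mul]
  · rw [hz θ h]

lemma Replicates.bicAt_iff (hψ : IsPrior ψ) (hz : Replicates ψ f u B P t z)
    (hrec : IsRecPolicy z) : BICAt ψ P (detD f u) u 0 t ↔ InBIC ψ (qAI B f u) u 0 z := by
  simp only [BICAt, InBIC, hrec, true_and, zero_mul]
  refine forall_congr' fun i => forall_congr' fun ai => forall_congr' fun ai' => ?_
  rw [hz.roundExp_eq hψ]
  simp only [mul_ite, mul_zero, mul_comm]

/-- Every round of a BIC policy is replicated by a BIC recommendation policy that is informed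
of all eventually-explorable actions. -/
lemma exists_replicates (hψ : IsPrior ψ) (hP : IsBIC ψ P (detD f u) u 0) (t : ℕ) :
    ∃ z, Replicates ψ f u (explSet ψ (detD f u) u 0) P t z ∧
      InBIC ψ (qAI (explSet ψ (detD f u) u 0) f u) u 0 z := by
  let z : JA A → AIVal A → ℝ := fun a s =>
    if hs : ∃ θ, allInfoVal (explSet ψ (detD f u) u 0) f u θ = s
    then probAt P (detD f u) hs.choose t a else P 0 [] a
  have hz : Replicates ψ f u (explSet ψ (detD f u) u 0) P t z := by
    intro θ _ G
    rw [roundCond_eq_sum_probAt]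
    refine Finset.sum_congr rfl fun a _ => ?_
    have hs : ∃ θ', allInfoVal (explSet ψ (detD f u) u 0) f u θ' =
      allInfoVal (explSet ψ (detD f u) u 0) f u θ := ⟨θ, rfl⟩
    have hza : z a (allInfoVal (explSet ψ (detD f u) u 0) f u θ) =
        probAt P (detD f u) hs.choose t a := dif_pos hs
    rw [hza, probAt_eq_of_allInfoVal_eq hP hs.choose_spec]
  have hrec : IsRecPolicy z := by
    refine ⟨fun a s => ?_, fun s => ?_⟩
    · by_cases hs : ∃ θ, allInfoVal (explSet ψ (detD f u) u 0) f u θ = s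
      · simpa only [z, dif_pos hs] using probAt_nonneg hP.1 _ t a
      · simpa only [z, dif_neg hs] using (hP.1 0 []).1 a
    · by_cases hs : ∃ θ, allInfoVal (explSet ψ (detD f u) u 0) f u θ = s
      · simpa only [z, dif_pos hs] using sum_probAt hP.1 _ t
      · simpa only [z, dif_neg hs] using (hP.1 0 []).2
  exact ⟨z, hz, (hz.bicAt_iff hψ hrec).1 (hP.2 t)⟩

end Deterministic

/-- (deterministic utilities) let `σ` be a maximally-exploring
subroutine of duration `Tσ` (a BIC subroutine with empty input signal that, with
probability 1, explores every eventually-explorable joint action by the time it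
stops), let `x` be an optimal BIC recommendation policy for the signal
`AllInfo(A^det_{θ*})`, and let `P` be the composition of `σ` followed by `T - Tσ`
copies of `x` (the signal being recovered from `σ`'s history via `g`). Then `P` is a
BIC iterative recommendation policy and `REW(P) ≥ (T - Tσ) · OPT(Π_BIC)`. -/
theorem max_explore_then_exploit
    {n : ℕ} {Θ : Type} {A : Fin n → Type} [Fintype Θ] [∀ i, Fintype (A i)]
    (ψ : Θ → ℝ) (f : JA A → Θ → ℝ) (u : (i : Fin n) → JA A → Θ → ℝ)
    (hψ : IsPrior ψ) (hu : IsUtil f u)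
    (σ : ℕ → Hist A → JA A → ℝ) (Tσ T : ℕ) (hT : Tσ ≤ T)
    (hσ : IsPolicy σ) (hσbic : ∀ t, t < Tσ → BICAt ψ σ (detD f u) u 0 t)
    (hexplore : ∀ θ : Θ, 0 < ψ θ → ∀ h : Hist A, h.length = Tσ →
      0 < histProb σ (detD f u) θ h →
      ∀ a ∈ explSet ψ (detD f u) u 0 θ, ∃ pr ∈ h, pr.1 = a)
    (x : JA A → AIVal A → ℝ)
    (hx : InBIC ψ (qAI (explSet ψ (detD f u) u 0) f u) u 0 x)
    (hxopt : ∀ y : JA A → AIVal A → ℝ,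
      InBIC ψ (qAI (explSet ψ (detD f u) u 0) f u) u 0 y →
        recREW ψ (qAI (explSet ψ (detD f u) u 0) f u) f y ≤
          recREW ψ (qAI (explSet ψ (detD f u) u 0) f u) f x)
    (g : Hist A → AIVal A)
    (hg : ∀ θ : Θ, 0 < ψ θ → ∀ h : Hist A, h.length = Tσ →
      0 < histProb σ (detD f u) θ h →
      g h = allInfoVal (explSet ψ (detD f u) u 0) f u θ)
    (P : ℕ → Hist A → JA A → ℝ)
    (hP : ∀ t h a, P t h a =
      if t < Tσ then σ t h a else x a (g (h.drop (h.length - Tσ)))) :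
    IsBIC ψ P (detD f u) u 0 ∧
      ((T : ℝ) - Tσ) * OPT ψ (detD f u) f (fun P' => IsBIC ψ P' (detD f u) u 0)
        ≤ REW ψ P (detD f u) f T := by
  have hpol : IsPolicy P := by
    intro t h
    by_cases ht : t < Tσ
    · simpa only [hP, if_pos ht] using hσ t h
    · simpa only [hP, if_neg ht] using
        And.intro (fun a => hx.1.1 a _) (hx.1.2 (g (h.drop (h.length - Tσ))))
  have hPσ : ∀ t h a, t < Tσ → P t h a = σ t h a := fun t h a ht => by rw [hP, if_pos ht]
  have hrep : ∀ t, Tσ ≤ t → Replicates ψ f u (explSet ψ (detD f u) u 0) P t x := by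
    intro t ht θ hθ G
    rw [roundCond, tsum_hist_eq_sum P θ t fun h => ∑ a : JA A, P t h a * G a θ,
      ← one_mul (∑ a : JA A, x a _ * G a θ), ← sum_histProb hpol θ t, Finset.sum_mul]
    refine Finset.sum_congr rfl fun h hh => ?_
    by_cases h₀ : histProb P (detD f u) θ h = 0
    · rw [h₀, zero_mul, zero_mul]
    have hlen : (h.drop (h.length - Tσ)).length = Tσ := by
      rw [List.length_drop, length_of_mem_detHist hh]
      omega
    have hne := histProb_drop_ne_zero h₀ (h.length - Tσ)
    rw [histProb_congr hPσ θ hlen.le] at hne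
    simp only [hP, if_neg (not_lt.2 ht),
      hg θ hθ _ hlen ((histProb_nonneg hσ θ _).lt_of_ne' hne)]
  have hbic : IsBIC ψ P (detD f u) u 0 := by
    refine ⟨hpol, fun t => ?_⟩
    rcases lt_or_ge t Tσ with ht | ht
    · have := hσbic t ht
      simpa only [BICAt, roundExp, roundCond_congr hPσ _ ht] using this
    · exact ((hrep t ht).bicAt_iff hψ hx.1).2 hx
  refine ⟨hbic, ?_⟩
  set R := recREW ψ (qAI (explSet ψ (detD f u) u 0) f u) f x
  have hopt : OPT ψ (detD f u) f (fun P' => IsBIC ψ P' (detD f u) u 0) ≤ R := by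
    refine csSup_le ⟨_, P, hbic, 0, rfl⟩ ?_
    rintro r ⟨P', hP', t, rfl⟩
    obtain ⟨z, hz, hzbic⟩ := exists_replicates hψ hP' t
    exact (hz.roundExp_eq hψ f).trans_le (hxopt z hzbic)
  have hsub : Finset.Ico Tσ T ⊆ Finset.range T := fun t ht =>
    Finset.mem_range.2 (Finset.mem_Ico.1 ht).2
  calc ((T : ℝ) - Tσ) * OPT ψ (detD f u) f (fun P' => IsBIC ψ P' (detD f u) u 0)
      ≤ ((T : ℝ) - Tσ) * R :=
        mul_le_mul_of_nonneg_left hopt (sub_nonneg.2 (Nat.cast_le.2 hT))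
    _ = ∑ t ∈ Finset.Ico Tσ T, roundExp ψ P (detD f u) t f := by
        rw [Finset.sum_congr rfl fun t ht =>
          (hrep t (Finset.mem_Ico.1 ht).1).roundExp_eq hψ f]
        rw [Finset.sum_const, Nat.card_Ico, nsmul_eq_mul, Nat.cast_sub hT]
        rfl
    _ ≤ REW ψ P (detD f u) f T :=
        Finset.sum_le_sum_of_subset_of_nonneg hsub fun t _ _ =>
          Finset.sum_nonneg fun θ _ =>
            mul_nonneg (hψ.1 θ) (roundCond_nonneg hpol fun a => (hu.1 a θ).1)

end BE

end
end

section
/- Characterization of the deterministic benchmark: for Bayesian Exploration with deterministic utilities, OPT(Π_BIC) = REW*[AllInfo(A^det_{θ*})]; that is, the one-round optimum over all BIC iterative recommendation policies equals the optimal expected reward of a BIC recommendation policy with access to the utilities of all eventually-explorable joint actions. -/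
open scoped BigOperators

attribute [local instance] Classical.propDecidable

noncomputable section

namespace BE

variable {n : ℕ} {Θ : Type} {A : Fin n → Type} {X : Type} {X' : Type}

/-- The environment in which the state is itself the table of realized utility vectors. -/
def tableD : JA A → (JA A → UVec n) → UVec n → ℝ :=
  fun a v w => if w = v a then (1:ℝ) else 0

/-- The table of realized utility vectors at state `θ`. -/
def table (f : JA A → Θ → ℝ) (u : (i : Fin n) → JA A → Θ → ℝ) (θ : Θ) : JA A → UVec n :=
  fun a => (f a θ, fun i => u i a θ)

theorem histProb_detD (P : ℕ → Hist A → JA A → ℝ) (f : JA A → Θ → ℝ)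
    (u : (i : Fin n) → JA A → Θ → ℝ) (θ : Θ) (h : Hist A) :
    histProb P (detD f u) θ h = histProb P tableD (table f u θ) h := by
  induction h with
  | nil => rfl
  | cons av h ih => simp only [histProb, ih, detD, tableD, table]; congr

section Expectation

variable [∀ i, Fintype (A i)]

/-- The histories of length `t` compatible with the table `v`. -/
def histories (v : JA A → UVec n) : ℕ → Finset (Hist A)
  | 0 => {[]}
  | t + 1 => (histories v t ×ˢ Finset.univ).image (fun p => (p.2, v p.2) :: p.1)

theorem length_of_mem_histories {v : JA A → UVec n} {t : ℕ} {h : Hist A}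
    (hh : h ∈ histories v t) : h.length = t := by
  induction t generalizing h with
  | zero => simp only [histories, Finset.mem_singleton] at hh; simp [hh]
  | succ t ih =>
    simp only [histories, Finset.mem_image, Finset.mem_product] at hh
    obtain ⟨p, ⟨hp, -⟩, rfl⟩ := hh
    simp [ih hp]

theorem mem_histories_of_histProb_ne_zero {P : ℕ → Hist A → JA A → ℝ} {v : JA A → UVec n}
    {h : Hist A} (hh : histProb P tableD v h ≠ 0) : h ∈ histories v h.length := by
  induction h with
  | nil => simp [histories]
  | cons av h ih =>
    simp only [histProb, tableD, ne_eq, mul_eq_zero, not_or, ite_eq_right_iff, one_ne_zero,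
      imp_false, not_not] at hh
    simp only [List.length_cons, histories, Finset.mem_image, Finset.mem_product]
    exact ⟨(h, av.1), ⟨ih hh.1.1, Finset.mem_univ _⟩, by rw [← hh.2]⟩

theorem histProb_nonneg_s10 {P : ℕ → Hist A → JA A → ℝ} (hP : IsPolicy P) (v : JA A → UVec n)
    (h : Hist A) : 0 ≤ histProb P tableD v h := by
  induction h with
  | nil => simp [histProb]
  | cons av h ih =>
    simp only [histProb, tableD]
    have := (hP h.length h).1 av.1
    split_ifs <;> positivity

/-- Expectation of `G` over the history of the first `t` rounds under the table `v`. -/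
def expect (P : ℕ → Hist A → JA A → ℝ) (v : JA A → UVec n) (t : ℕ) (G : Hist A → ℝ) : ℝ :=
  ∑ h ∈ histories v t, histProb P tableD v h * G h

theorem tsum_eq_expect (P : ℕ → Hist A → JA A → ℝ) (v : JA A → UVec n) (t : ℕ)
    (G : Hist A → ℝ) :
    (∑' h : Hist A, if h.length = t then histProb P tableD v h * G h else 0)
      = expect P v t G := by
  rw [tsum_eq_sum (s := histories v t), expect]
  · exact Finset.sum_congr rfl fun h hh => if_pos (length_of_mem_histories hh)
  · intro h hh
    split_ifs with ht
    · subst ht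
      by_cases h0 : histProb P tableD v h = 0
      · simp [h0]
      · exact absurd (mem_histories_of_histProb_ne_zero h0) hh
    · rfl

theorem expect_zero (P : ℕ → Hist A → JA A → ℝ) (v : JA A → UVec n) (G : Hist A → ℝ) :
    expect P v 0 G = G [] := by
  simp [expect, histories, histProb]

theorem expect_succ (P : ℕ → Hist A → JA A → ℝ) (v : JA A → UVec n) (t : ℕ)
    (G : Hist A → ℝ) :
    expect P v (t + 1) G = expect P v t (fun h => ∑ a, P t h a * G ((a, v a) :: h)) := by
  simp only [expect, histories]
  rw [Finset.sum_image, Finset.sum_product]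
  · refine Finset.sum_congr rfl fun h hh => ?_
    rw [Finset.mul_sum]
    refine Finset.sum_congr rfl fun a _ => ?_
    simp only [histProb, tableD, length_of_mem_histories hh, if_true]
    ring
  · rintro ⟨h, a⟩ - ⟨h', a'⟩ - heq
    simp only [List.cons.injEq, Prod.mk.injEq] at heq
    exact Prod.ext heq.2 heq.1.1

theorem expect_add (P : ℕ → Hist A → JA A → ℝ) (v : JA A → UVec n) (t : ℕ)
    (G H : Hist A → ℝ) :
    expect P v t (fun h => G h + H h) = expect P v t G + expect P v t H := by
  simp only [expect, mul_add, Finset.sum_add_distrib]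

theorem expect_mul_const (P : ℕ → Hist A → JA A → ℝ) (v : JA A → UVec n) (t : ℕ)
    (G : Hist A → ℝ) (c : ℝ) :
    expect P v t (fun h => G h * c) = expect P v t G * c := by
  simp only [expect, Finset.sum_mul, mul_assoc]

theorem expect_sum {ι : Type*} (s : Finset ι) (P : ℕ → Hist A → JA A → ℝ)
    (v : JA A → UVec n) (t : ℕ) (G : ι → Hist A → ℝ) :
    expect P v t (fun h => ∑ j ∈ s, G j h) = ∑ j ∈ s, expect P v t (G j) := by
  simp only [expect, Finset.mul_sum]
  exact Finset.sum_comm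

theorem expect_one {P : ℕ → Hist A → JA A → ℝ} (hP : IsPolicy P) (v : JA A → UVec n) (t : ℕ) :
    expect P v t (fun _ => 1) = 1 := by
  induction t with
  | zero => exact expect_zero ..
  | succ t ih => simpa [expect_succ, (hP _ _).2] using ih

theorem expect_const {P : ℕ → Hist A → JA A → ℝ} (hP : IsPolicy P) (v : JA A → UVec n) (t : ℕ)
    (c : ℝ) : expect P v t (fun _ => c) = c := by
  simpa [expect_one hP] using expect_mul_const P v t (fun _ => 1) c

theorem expect_mono {P : ℕ → Hist A → JA A → ℝ} (hP : IsPolicy P) {v : JA A → UVec n} {t : ℕ}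
    {G H : Hist A → ℝ}
    (hGH : ∀ h, h.length = t → 0 < histProb P tableD v h → G h ≤ H h) :
    expect P v t G ≤ expect P v t H := by
  refine Finset.sum_le_sum fun h hh => ?_
  rcases (histProb_nonneg_s10 hP v h).eq_or_lt with h0 | h0
  · simp [← h0]
  · exact mul_le_mul_of_nonneg_left (hGH h (length_of_mem_histories hh) h0) h0.le

theorem expect_congr {P : ℕ → Hist A → JA A → ℝ} (hP : IsPolicy P) {v : JA A → UVec n} {t : ℕ}
    {G H : Hist A → ℝ}
    (hGH : ∀ h, h.length = t → 0 < histProb P tableD v h → G h = H h) :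
    expect P v t G = expect P v t H :=
  le_antisymm (expect_mono hP fun h ht h0 => (hGH h ht h0).le)
    (expect_mono hP fun h ht h0 => (hGH h ht h0).ge)

theorem expect_congr_policy {P Q : ℕ → Hist A → JA A → ℝ} (v : JA A → UVec n) {t : ℕ}
    (hPQ : ∀ s < t, P s = Q s) (G : Hist A → ℝ) : expect P v t G = expect Q v t G := by
  induction t generalizing G with
  | zero => simp only [expect_zero]
  | succ t ih =>
    rw [expect_succ, expect_succ, ih fun s hs => hPQ s (hs.trans t.lt_succ_self),
      hPQ t t.lt_succ_self]

theorem expect_pos_of_histProb_pos {P : ℕ → Hist A → JA A → ℝ} (hP : IsPolicy P)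
    {v : JA A → UVec n} {h : Hist A} (hh : 0 < histProb P tableD v h) {G : Hist A → ℝ}
    (hG : ∀ h, 0 ≤ G h) (hGh : 0 < G h) : 0 < expect P v h.length G :=
  Finset.sum_pos' (fun h' _ => mul_nonneg (histProb_nonneg_s10 hP v h') (hG h'))
    ⟨h, mem_histories_of_histProb_ne_zero hh.ne', mul_pos hh hGh⟩

end Expectation

section Explorable

variable [∀ i, Fintype (A i)]

/-- The joint actions played with positive probability, under the table `v`, in some round by
some policy of the class `C`. -/
def explorable (C : (ℕ → Hist A → JA A → ℝ) → Prop) (v : JA A → UVec n) : Set (JA A) :=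
  {a | ∃ P, C P ∧ ∃ t, 0 < expect P v t (fun h => P t h a)}

variable {C : (ℕ → Hist A → JA A → ℝ) → Prop}

theorem mem_explorable_of_pos (hC : ∀ P, C P → IsPolicy P)
    {P : ℕ → Hist A → JA A → ℝ} (hP : C P) {v : JA A → UVec n}
    {h : Hist A} (hh : 0 < histProb P tableD v h) {a : JA A} (ha : 0 < P h.length h a) :
    a ∈ explorable C v :=
  ⟨P, hP, h.length,
    expect_pos_of_histProb_pos (hC P hP) hh (fun h' => (hC P hP _ h').1 a) ha⟩

theorem forall_mem_of_histProb_pos (hC : ∀ P, C P → IsPolicy P)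
    {P : ℕ → Hist A → JA A → ℝ} (hP : C P)
    {v : JA A → UVec n} {h : Hist A} (hh : 0 < histProb P tableD v h) :
    ∀ p ∈ h, p.1 ∈ explorable C v ∧ p.2 = v p.1 := by
  induction h with
  | nil => simp
  | cons av h ih =>
    simp only [histProb, tableD] at hh
    have hv : av.2 = v av.1 := by
      by_contra hne
      simp [hne] at hh
    rw [if_pos hv, mul_one] at hh
    have h0 : 0 < histProb P tableD v h := by
      refine (histProb_nonneg_s10 (hC P hP) v h).lt_of_ne' fun h0 => ?_
      simp [h0] at hh
    have ha : 0 < P h.length h av.1 := pos_of_mul_pos_right hh h0.le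
    intro p hp
    rcases List.mem_cons.1 hp with rfl | hp
    · exact ⟨mem_explorable_of_pos hC hP h0 ha, hv⟩
    · exact ih h0 p hp

theorem expect_congr_table (hC : ∀ P, C P → IsPolicy P)
    {P : ℕ → Hist A → JA A → ℝ} (hP : C P) {v w : JA A → UVec n}
    (hvw : ∀ a ∈ explorable C v, w a = v a) (t : ℕ) (G : Hist A → ℝ) :
    expect P w t G = expect P v t G := by
  induction t generalizing G with
  | zero => simp only [expect_zero]
  | succ t ih =>
    rw [expect_succ, expect_succ, ih]
    refine expect_congr (hC P hP) fun h ht h0 => Finset.sum_congr rfl fun a _ => ?_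
    subst ht
    rcases ((hC P hP h.length h).1 a).eq_or_lt with ha | ha
    · simp [← ha]
    · rw [hvw a (mem_explorable_of_pos hC hP h0 ha)]

theorem explorable_congr (hC : ∀ P, C P → IsPolicy P)
    {v w : JA A → UVec n} (hvw : ∀ a ∈ explorable C v, w a = v a) :
    explorable C w = explorable C v := by
  ext a
  exact exists_congr fun P => and_congr_right fun hP => exists_congr fun t => by
    rw [expect_congr_table hC hP hvw]

end Explorable

section Concatenation

/-- Follow `P` for `L` rounds, then restart with `Q`, forgetting the first `L` rounds. -/
def concat (P : ℕ → Hist A → JA A → ℝ) (L : ℕ) (Q : ℕ → Hist A → JA A → ℝ) :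
    ℕ → Hist A → JA A → ℝ :=
  fun t h => if t < L then P t h else Q (t - L) (h.take (t - L))

theorem concat_of_lt {P Q : ℕ → Hist A → JA A → ℝ} {L t : ℕ} (ht : t < L) :
    concat P L Q t = P t := by
  funext h
  simp [concat, ht]

theorem concat_add (P Q : ℕ → Hist A → JA A → ℝ) (L M : ℕ) (h : Hist A) :
    concat P L Q (L + M) h = Q M (h.take M) := by
  simp [concat]

variable [∀ i, Fintype (A i)]

theorem concat_isPolicy {P Q : ℕ → Hist A → JA A → ℝ} (hP : IsPolicy P) (L : ℕ)
    (hQ : IsPolicy Q) : IsPolicy (concat P L Q) := by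
  intro t h
  unfold concat
  split_ifs
  · exact hP t h
  · exact hQ _ _

/-- The two stages of a concatenated policy are independent given the table. -/
theorem expect_concat_mul (P Q : ℕ → Hist A → JA A → ℝ) (L M : ℕ) (v : JA A → UVec n)
    (G H : Hist A → ℝ) :
    expect (concat P L Q) v (L + M) (fun h => G (h.take M) * H (h.drop M))
      = expect Q v M G * expect P v L H := by
  induction M generalizing G with
  | zero =>
    rw [add_zero, expect_congr_policy v (fun s hs => concat_of_lt hs), expect_zero, mul_comm,
      ← expect_mul_const]
    simp [mul_comm]
  | succ M ih =>
    rw [← add_assoc, expect_succ, expect_succ, ← ih]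
    simp only [concat_add, List.take_succ_cons, List.drop_succ_cons, Finset.sum_mul, mul_assoc]

theorem expect_concat {P : ℕ → Hist A → JA A → ℝ} (hP : IsPolicy P)
    (Q : ℕ → Hist A → JA A → ℝ) (L M : ℕ) (v : JA A → UVec n) (G : Hist A → ℝ) :
    expect (concat P L Q) v (L + M) (fun h => G (h.take M)) = expect Q v M G := by
  simpa [expect_one hP] using expect_concat_mul P Q L M v G (fun _ => 1)

/-- The probability that `a` is not played in the first `L` rounds under the table `v`. -/
def missProb (P : ℕ → Hist A → JA A → ℝ) (L : ℕ) (v : JA A → UVec n) (a : JA A) : ℝ :=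
  expect P v L (fun h => if a ∈ h.map Prod.fst then 0 else 1)

theorem missProb_nonneg {P : ℕ → Hist A → JA A → ℝ} (hP : IsPolicy P) (L : ℕ)
    (v : JA A → UVec n) (a : JA A) : 0 ≤ missProb P L v a :=
  (expect_const hP v L 0).symm.le.trans
    (expect_mono hP fun h _ _ => by split_ifs <;> norm_num)

theorem missProb_le_one {P : ℕ → Hist A → JA A → ℝ} (hP : IsPolicy P) (L : ℕ)
    (v : JA A → UVec n) (a : JA A) : missProb P L v a ≤ 1 :=
  (expect_mono hP fun h _ _ => by split_ifs <;> norm_num).trans (expect_one hP v L).le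

theorem missProb_concat (P Q : ℕ → Hist A → JA A → ℝ) (L M : ℕ) (v : JA A → UVec n)
    (a : JA A) :
    missProb (concat P L Q) (L + M) v a = missProb Q M v a * missProb P L v a := by
  rw [missProb, missProb, missProb, ← expect_concat_mul]
  congr 1
  funext h
  have : a ∈ h.map Prod.fst ↔
      a ∈ (h.take M).map Prod.fst ∨ a ∈ (h.drop M).map Prod.fst := by
    rw [← List.mem_append, ← List.map_append, List.take_append_drop]
  by_cases h1 : a ∈ (h.take M).map Prod.fst <;> by_cases h2 : a ∈ (h.drop M).map Prod.fst <;>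
    simp only [this, h1, h2, or_true, true_or, or_self, if_true, if_false, mul_zero,
      mul_one]

theorem missProb_succ_lt_one {P : ℕ → Hist A → JA A → ℝ} (hP : IsPolicy P) {t : ℕ}
    {v : JA A → UVec n} {a : JA A} (ha : 0 < expect P v t (fun h => P t h a)) :
    missProb P (t + 1) v a < 1 := by
  have hle : missProb P (t + 1) v a ≤ expect P v t (fun h => 1 + P t h a * (-1)) := by
    rw [missProb, expect_succ]
    refine expect_mono hP fun h _ _ => ?_
    have hs : ∑ b, P t h b * (if b = a then (0:ℝ) else 1) = 1 + P t h a * (-1) := by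
      have hb : ∀ b, P t h b * (if b = a then (0:ℝ) else 1)
          = P t h b - if b = a then P t h b else 0 := fun b => by split_ifs <;> simp
      simp only [hb, Finset.sum_sub_distrib, (hP t h).2, Finset.sum_ite_eq', Finset.mem_univ,
        if_true]
      ring
    rw [← hs]
    refine Finset.sum_le_sum fun b _ => mul_le_mul_of_nonneg_left ?_ ((hP t h).1 b)
    by_cases hb : b = a
    · simp [hb]
    · rw [if_neg hb]
      split_ifs <;> simp
  rw [expect_add, expect_one hP, expect_mul_const] at hle
  linarith

variable {C : (ℕ → Hist A → JA A → ℝ) → Prop}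

theorem exists_missProb_lt (hC : ∀ P, C P → IsPolicy P)
    (hcat : ∀ P Q L, C P → C Q → C (concat P L Q)) {v : JA A → UVec n}
    {a : JA A} (ha : a ∈ explorable C v) {ε : ℝ} (hε : 0 < ε) : ∃ P, C P ∧ ∃ L, missProb P L v a < ε := by
  obtain ⟨P, hP, t, ht⟩ := ha
  have hpow : ∀ k : ℕ, ∃ Q, C Q ∧ ∃ L, missProb Q L v a ≤ missProb P (t + 1) v a ^ k := by
    intro k
    induction k with
    | zero => exact ⟨P, hP, 0, by simpa using missProb_le_one (hC P hP) 0 v a⟩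
    | succ k ih =>
      obtain ⟨Q, hQ, L, hL⟩ := ih
      refine ⟨concat P (t + 1) Q, hcat _ _ _ hP hQ, t + 1 + L, ?_⟩
      rw [missProb_concat, pow_succ]
      exact mul_le_mul_of_nonneg_right hL (missProb_nonneg (hC P hP) _ _ _)
  obtain ⟨k, hk⟩ := exists_pow_lt_of_lt_one hε (missProb_succ_lt_one (hC P hP) ht)
  obtain ⟨Q, hQ, L, hL⟩ := hpow k
  exact ⟨Q, hQ, L, hL.trans_lt hk⟩

theorem exists_forall_missProb_lt (hC : ∀ P, C P → IsPolicy P)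
    (hcat : ∀ P Q L, C P → C Q → C (concat P L Q)) {P₀ : ℕ → Hist A → JA A → ℝ} (hP₀ : C P₀)
    (S : Finset ((JA A → UVec n) × JA A)) (hS : ∀ p ∈ S, p.2 ∈ explorable C p.1) {ε : ℝ}
    (hε : 0 < ε) : ∃ P, C P ∧ ∃ L, ∀ p ∈ S, missProb P L p.1 p.2 < ε := by
  induction S using Finset.induction_on with
  | empty => exact ⟨P₀, hP₀, 0, by simp⟩
  | insert p S _ ih =>
    obtain ⟨P, hP, L, hL⟩ := ih fun q hq => hS q (Finset.mem_insert_of_mem hq)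
    obtain ⟨Q, hQ, M, hM⟩ :=
      exists_missProb_lt hC hcat (hS p (Finset.mem_insert_self p S)) hε
    refine ⟨concat P L Q, hcat _ _ _ hP hQ, L + M, fun q hq => ?_⟩
    rw [missProb_concat]
    rcases Finset.mem_insert.1 hq with rfl | hq
    · exact (mul_le_of_le_one_right (missProb_nonneg (hC Q hQ) _ _ _)
        (missProb_le_one (hC P hP) _ _ _)).trans_lt hM
    · exact (mul_le_of_le_one_left (missProb_nonneg (hC P hP) _ _ _)
        (missProb_le_one (hC Q hQ) _ _ _)).trans_lt (hL q hq)

end Concatenation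

section Signal

/-- The restriction of the table `v` to the set `B`, as an `AllInfo` signal value. -/
def restrict (B : Finset (JA A)) (v : JA A → UVec n) : AIVal A :=
  (B, fun a => if a ∈ B then v a else (((0:ℝ), fun _ => (0:ℝ)) : UVec n))

/-- The `AllInfo` signal value read off a history. -/
def observed (h : Hist A) : AIVal A :=
  restrict (h.map Prod.fst).toFinset (fun a =>
    if ha : ∃ w, (a, w) ∈ h then ha.choose else (((0:ℝ), fun _ => (0:ℝ)) : UVec n))

theorem observed_eq_restrict {v : JA A → UVec n} {h : Hist A}
    (hv : ∀ p ∈ h, p.2 = v p.1) : observed h = restrict (h.map Prod.fst).toFinset v := by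
  refine Prod.ext rfl (funext fun a => ?_)
  simp only [observed, restrict]
  split_ifs with h1 h2
  · exact hv _ h2.choose_spec
  · obtain ⟨p, hp, rfl⟩ := List.mem_map.1 (List.mem_toFinset.1 h1)
    exact absurd ⟨p.2, hp⟩ h2
  · rfl

theorem restrict_eq_iff {B B' : Finset (JA A)} {v v' : JA A → UVec n} :
    restrict B v = restrict B' v' ↔ B = B' ∧ ∀ a ∈ B, v a = v' a := by
  constructor
  · intro h
    have hB : B = B' := congrArg Prod.fst h
    subst hB
    refine ⟨rfl, fun a ha => ?_⟩
    have := congrFun (congrArg Prod.snd h) a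
    simpa only [restrict, if_pos ha] using this
  · rintro ⟨rfl, h⟩
    refine Prod.ext rfl (funext fun a => ?_)
    simp only [restrict]
    split_ifs with ha
    · exact h a ha
    · rfl

variable [∀ i, Fintype (A i)]

theorem allInfoVal_eq_restrict (B : Θ → Finset (JA A)) (f : JA A → Θ → ℝ)
    (u : (i : Fin n) → JA A → Θ → ℝ) (θ : Θ) :
    allInfoVal B f u θ = restrict (B θ) (table f u θ) :=
  rfl

end Signal

section BestReward

variable [∀ i, Fintype (A i)]

/-- Play `F` in round `L`, after following `P` for `L` rounds; afterwards, play `r`. -/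
def probeThen (P : ℕ → Hist A → JA A → ℝ) (L : ℕ) (F : Hist A → JA A → ℝ) (r : JA A → ℝ) :
    ℕ → Hist A → JA A → ℝ :=
  fun t h => if t < L then P t h else if t = L then F h else r

/-- The utility gain of agent `i` from following the recommendation `ai` rather than playing
`ai'`, on the event that `ai` is recommended. -/
def gain (u : (i : Fin n) → JA A → Θ → ℝ) (i : Fin n) (ai ai' : A i) : JA A → Θ → ℝ :=
  fun a θ => if a i = ai then u i a θ - u i (Function.update a i ai') θ else 0

theorem probAt_detD (P : ℕ → Hist A → JA A → ℝ) (f : JA A → Θ → ℝ)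
    (u : (i : Fin n) → JA A → Θ → ℝ) (θ : Θ) (t : ℕ) (a : JA A) :
    probAt P (detD f u) θ t a = expect P (table f u θ) t (fun h => P t h a) := by
  rw [← tsum_eq_expect]
  simp only [probAt, histProb_detD]

theorem tsum_qAI_mul (B : Θ → Finset (JA A)) (f : JA A → Θ → ℝ)
    (u : (i : Fin n) → JA A → Θ → ℝ) (θ : Θ) (K : AIVal A → ℝ) :
    ∑' s, qAI B f u θ s * K s = K (allInfoVal B f u θ) := by
  rw [tsum_eq_single (allInfoVal B f u θ)]
  · simp [qAI]
  · intro s hs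
    simp [qAI, hs]

variable [Fintype Θ]

theorem roundExp_detD (ψ : Θ → ℝ) (P : ℕ → Hist A → JA A → ℝ) (f : JA A → Θ → ℝ)
    (u : (i : Fin n) → JA A → Θ → ℝ) (t : ℕ) (g : JA A → Θ → ℝ) :
    roundExp ψ P (detD f u) t g
      = ∑ θ, ψ θ * expect P (table f u θ) t (fun h => ∑ a, P t h a * g a θ) := by
  simp only [roundExp, roundCond, histProb_detD, tsum_eq_expect]

theorem isBIC_zero_iff (ψ : Θ → ℝ) (P : ℕ → Hist A → JA A → ℝ)
    (D : JA A → Θ → UVec n → ℝ) (u : (i : Fin n) → JA A → Θ → ℝ) :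
    IsBIC ψ P D u 0 ↔
      IsPolicy P ∧ ∀ t i ai ai', 0 ≤ roundExp ψ P D t (gain u i ai ai') := by
  simp only [IsBIC, BICAt, zero_mul]
  rfl

/-- The expectation of `g` when `x` is applied to the signal `AllInfo(B)`. -/
def recExp (ψ : Θ → ℝ) (B : Θ → Finset (JA A)) (f : JA A → Θ → ℝ)
    (u : (i : Fin n) → JA A → Θ → ℝ) (x : JA A → AIVal A → ℝ) (g : JA A → Θ → ℝ) : ℝ :=
  ∑ θ, ψ θ * ∑ a, x a (allInfoVal B f u θ) * g a θ

theorem recREW_qAI (ψ : Θ → ℝ) (B : Θ → Finset (JA A)) (f : JA A → Θ → ℝ)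
    (u : (i : Fin n) → JA A → Θ → ℝ) (x : JA A → AIVal A → ℝ) :
    recREW ψ (qAI B f u) f x = recExp ψ B f u x f := by
  simp only [recREW, recExp, tsum_qAI_mul]

theorem inBIC_qAI_zero_iff (ψ : Θ → ℝ) (B : Θ → Finset (JA A)) (f : JA A → Θ → ℝ)
    (u : (i : Fin n) → JA A → Θ → ℝ) (x : JA A → AIVal A → ℝ) :
    InBIC ψ (qAI B f u) u 0 x ↔
      IsRecPolicy x ∧ ∀ i ai ai', 0 ≤ recExp ψ B f u x (gain u i ai ai') := by
  simp only [InBIC, tsum_qAI_mul, zero_mul, recExp, gain, mul_comm (x _ _), ite_mul,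
    zero_mul]

variable {ψ : Θ → ℝ} {f : JA A → Θ → ℝ} {u : (i : Fin n) → JA A → Θ → ℝ}

theorem recExp_mem_Icc (hψ : IsPrior ψ) (hu : IsUtil f u) (B : Θ → Finset (JA A))
    {x : JA A → AIVal A → ℝ} (hx : IsRecPolicy x) :
    recExp ψ B f u x f ∈ Set.Icc (0:ℝ) 1 := by
  have h1 : ∀ θ, ∑ a, x a (allInfoVal B f u θ) * f a θ ∈ Set.Icc (0:ℝ) 1 := by
    refine fun θ => ⟨Finset.sum_nonneg fun a _ => mul_nonneg (hx.1 _ _) (hu.1 a θ).1, ?_⟩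
    rw [← hx.2 (allInfoVal B f u θ)]
    exact Finset.sum_le_sum fun a _ => mul_le_of_le_one_right (hx.1 _ _) (hu.1 a θ).2
  refine ⟨Finset.sum_nonneg fun θ _ => mul_nonneg (hψ.1 θ) (h1 θ).1, ?_⟩
  rw [← hψ.2]
  exact Finset.sum_le_sum fun θ _ => mul_le_of_le_one_right (hψ.1 θ) (h1 θ).2

theorem concat_isBIC {P Q : ℕ → Hist A → JA A → ℝ} (hP : IsBIC ψ P (detD f u) u 0)
    (hQ : IsBIC ψ Q (detD f u) u 0) (L : ℕ) : IsBIC ψ (concat P L Q) (detD f u) u 0 := by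
  rw [isBIC_zero_iff] at hP hQ ⊢
  refine ⟨concat_isPolicy hP.1 L hQ.1, fun t i ai ai' => ?_⟩
  rcases lt_or_ge t L with ht | ht
  · convert hP.2 t i ai ai' using 1
    simp only [roundExp_detD, concat_of_lt ht,
      expect_congr_policy _ fun s hs => concat_of_lt (lt_trans hs ht)]
  · obtain ⟨M, rfl⟩ := Nat.exists_eq_add_of_le ht
    convert hQ.2 M i ai ai' using 1
    simp only [roundExp_detD, concat_add]
    refine Finset.sum_congr rfl fun θ _ => ?_
    rw [expect_concat hP.1 Q L M _ (fun h => ∑ a, Q M h a * gain u i ai ai' a θ)]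

theorem mem_explSet {θ : Θ} {a : JA A} :
    a ∈ explSet ψ (detD f u) u 0 θ ↔
      a ∈ explorable (fun P => IsBIC ψ P (detD f u) u 0) (table f u θ) := by
  simp only [explSet, probAt_detD, explorable, Set.Finite.mem_toFinset]

/-- Simulating a BIC policy on the revealed utilities loses nothing. -/
theorem exists_inBIC_recExp_eq {P : ℕ → Hist A → JA A → ℝ}
    (hP : IsBIC ψ P (detD f u) u 0) (t : ℕ) :
    ∃ x, InBIC ψ (qAI (explSet ψ (detD f u) u 0) f u) u 0 x ∧
      recExp ψ (explSet ψ (detD f u) u 0) f u x f = roundExp ψ P (detD f u) t f := by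
  let x : JA A → AIVal A → ℝ := fun a s => expect P s.2 t (fun h => P t h a)
  have hx : IsRecPolicy x := by
    refine ⟨fun a s => ?_, fun s => ?_⟩
    · rw [← expect_const hP.1 s.2 t 0]
      exact expect_mono hP.1 fun h _ _ => (hP.1 t h).1 a
    · rw [← expect_one hP.1 s.2 t, ← expect_sum]
      simp only [(hP.1 _ _).2]
  have hxg : ∀ g, recExp ψ (explSet ψ (detD f u) u 0) f u x g
      = roundExp ψ P (detD f u) t g := by
    intro g
    rw [roundExp_detD]
    refine Finset.sum_congr rfl fun θ _ => ?_
    rw [expect_sum]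
    congr 1
    refine Finset.sum_congr rfl fun a _ => ?_
    rw [expect_mul_const, ← expect_congr_table (C := fun P => IsBIC ψ P (detD f u) u 0)
      (fun _ h => h.1) hP (w := (allInfoVal (explSet ψ (detD f u) u 0) f u θ).2)]
    intro b hb
    exact if_pos (mem_explSet.2 hb)
  refine ⟨x, (inBIC_qAI_zero_iff ..).2 ⟨hx, fun i ai ai' => ?_⟩, hxg f⟩
  rw [hxg]
  exact ((isBIC_zero_iff ..).1 hP).2 t i ai ai'

/-- If there is a BIC recommendation policy, there is a BIC iterative one. -/
theorem exists_isBIC_of_inBIC {x : JA A → AIVal A → ℝ}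
    (hx : InBIC ψ (qAI (explSet ψ (detD f u) u 0) f u) u 0 x) :
    ∃ P, IsBIC ψ P (detD f u) u 0 := by
  by_contra hne
  push Not at hne
  rw [inBIC_qAI_zero_iff] at hx
  let s : AIVal A := restrict ∅ (fun _ => (0, fun _ => 0))
  have hs : ∀ θ, allInfoVal (explSet ψ (detD f u) u 0) f u θ = s := by
    intro θ
    rw [allInfoVal_eq_restrict, restrict_eq_iff]
    have hempty : explSet ψ (detD f u) u 0 θ = ∅ := by
      refine Finset.eq_empty_of_forall_notMem fun a ha => ?_
      obtain ⟨P, hP, -⟩ := mem_explSet.1 ha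
      exact hne P hP
    rw [hempty]
    simp
  have hpol : IsPolicy (fun _ (_ : Hist A) a => x a s) :=
    fun _ _ => ⟨fun a => hx.1.1 a s, hx.1.2 s⟩
  refine hne _ ((isBIC_zero_iff ..).2 ⟨hpol, fun t i ai ai' => ?_⟩)
  simpa only [roundExp_detD, expect_const hpol, recExp, hs] using hx.2 i ai ai'

/-- A history that reveals some `AllInfo` signal value reveals the correct one. -/
theorem allInfoVal_eq_of_observed_eq {P : ℕ → Hist A → JA A → ℝ}
    (hP : IsBIC ψ P (detD f u) u 0) {θ θ' : Θ} {h : Hist A}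
    (hh : 0 < histProb P tableD (table f u θ) h)
    (hobs : observed h = allInfoVal (explSet ψ (detD f u) u 0) f u θ') :
    observed h = allInfoVal (explSet ψ (detD f u) u 0) f u θ := by
  have hC : ∀ P, IsBIC ψ P (detD f u) u 0 → IsPolicy P := fun _ h => h.1
  have hmem := forall_mem_of_histProb_pos hC hP hh
  rw [observed_eq_restrict fun p hp => (hmem p hp).2, allInfoVal_eq_restrict,
    restrict_eq_iff] at hobs ⊢
  refine ⟨?_, fun _ _ => rfl⟩
  obtain ⟨hB, hv⟩ := hobs
  rw [hB] at hv ⊢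
  ext a
  rw [mem_explSet, mem_explSet, explorable_congr hC fun b hb => hv b (mem_explSet.2 hb)]

theorem exists_le_expect_observed {P₀ : ℕ → Hist A → JA A → ℝ}
    (hP₀ : IsBIC ψ P₀ (detD f u) u 0) {c : ℝ} (hc : c < 1) :
    ∃ P, IsBIC ψ P (detD f u) u 0 ∧ ∃ L, ∀ θ,
      c ≤ expect P (table f u θ) L (fun h =>
        if observed h = allInfoVal (explSet ψ (detD f u) u 0) f u θ then 1 else 0) := by
  have hC : ∀ P, IsBIC ψ P (detD f u) u 0 → IsPolicy P := fun _ h => h.1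
  let B := explSet ψ (detD f u) u 0
  let ε : ℝ := (1 - c) / (Fintype.card (JA A) + 1)
  have hε : 0 < ε := div_pos (by linarith) (by positivity)
  obtain ⟨P, hP, L, hL⟩ := exists_forall_missProb_lt hC
    (fun P Q L hP hQ => concat_isBIC hP hQ L) hP₀
    (Finset.univ.biUnion fun θ => (B θ).image fun a => (table f u θ, a))
    (by
      intro p hp
      simp only [Finset.mem_biUnion, Finset.mem_image] at hp
      obtain ⟨θ, -, a, ha, rfl⟩ := hp
      exact mem_explSet.1 ha) hε
  refine ⟨P, hP, L, fun θ => ?_⟩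
  have hmiss : ∑ a ∈ B θ, missProb P L (table f u θ) a ≤ 1 - c := by
    calc ∑ a ∈ B θ, missProb P L (table f u θ) a
        ≤ ∑ _a ∈ B θ, ε := Finset.sum_le_sum fun a ha => (hL (table f u θ, a)
          (Finset.mem_biUnion.2 ⟨θ, Finset.mem_univ θ, Finset.mem_image_of_mem _ ha⟩)).le
      _ = (B θ).card * ε := by rw [Finset.sum_const, nsmul_eq_mul]
      _ ≤ (Fintype.card (JA A) + 1) * ε := by
          have : ((B θ).card : ℝ) ≤ Fintype.card (JA A) := by
            exact_mod_cast Finset.card_le_univ (B θ)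
          exact mul_le_mul_of_nonneg_right (by linarith) hε.le
      _ = 1 - c := mul_div_cancel₀ _ (by positivity)
  have hle : 1 ≤ expect P (table f u θ) L (fun h =>
      (if observed h = allInfoVal B f u θ then 1 else 0)
        + ∑ a ∈ B θ, if a ∈ h.map Prod.fst then (0:ℝ) else 1) := by
    refine (expect_one hP.1 (table f u θ) L).symm.le.trans (expect_mono hP.1 fun h _ hh => ?_)
    have hnn : ∀ a ∈ B θ, 0 ≤ if a ∈ h.map Prod.fst then (0:ℝ) else 1 :=
      fun a _ => by split_ifs <;> norm_num
    by_cases hall : ∀ a ∈ B θ, a ∈ h.map Prod.fst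
    · have hmem := forall_mem_of_histProb_pos hC hP hh
      have : observed h = allInfoVal B f u θ := by
        rw [observed_eq_restrict fun p hp => (hmem p hp).2, allInfoVal_eq_restrict,
          restrict_eq_iff]
        refine ⟨Finset.Subset.antisymm (fun a ha => ?_)
          fun a ha => List.mem_toFinset.2 (hall a ha), fun _ _ => rfl⟩
        obtain ⟨p, hp, rfl⟩ := List.mem_map.1 (List.mem_toFinset.1 ha)
        exact mem_explSet.2 (hmem p hp).1
      rw [if_pos this]
      linarith [Finset.sum_nonneg hnn]
    · push Not at hall
      obtain ⟨a, ha, hah⟩ := hall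
      have h1 := Finset.single_le_sum hnn ha
      rw [if_neg hah] at h1
      have h2 : (0:ℝ) ≤ if observed h = allInfoVal B f u θ then 1 else 0 := by
        split_ifs <;> norm_num
      linarith
  rw [expect_add, expect_sum] at hle
  simp only [missProb] at hmiss
  linarith

/-- Any reward attainable from full access to the explorable utilities is attained, up to
mixing with a fixed reward, by a round of a BIC policy. -/
theorem exists_isBIC_roundExp_eq {P₀ : ℕ → Hist A → JA A → ℝ}
    (hP₀ : IsBIC ψ P₀ (detD f u) u 0) {x : JA A → AIVal A → ℝ}
    (hx : InBIC ψ (qAI (explSet ψ (detD f u) u 0) f u) u 0 x) {c : ℝ} (hc0 : 0 < c)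
    (hc1 : c < 1) :
    ∃ P, IsBIC ψ P (detD f u) u 0 ∧ ∃ t, roundExp ψ P (detD f u) t f =
      c * recExp ψ (explSet ψ (detD f u) u 0) f u x f
        + (1 - c) * roundExp ψ P₀ (detD f u) 0 f := by
  obtain ⟨P, hP, L, hL⟩ := exists_le_expect_observed hP₀ hc1
  have hC : ∀ P, IsBIC ψ P (detD f u) u 0 → IsPolicy P := fun _ h => h.1
  rw [inBIC_qAI_zero_iff] at hx
  set B := explSet ψ (detD f u) u 0
  let sig : Θ → AIVal A := allInfoVal B f u
  let p : AIVal A → ℝ := fun s => expect P s.2 L (fun h => if observed h = s then 1 else 0)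
  have hp : ∀ θ, p (sig θ) = expect P (table f u θ) L
      (fun h => if observed h = sig θ then 1 else 0) := fun θ =>
    expect_congr_table hC hP (fun a ha => if_pos (mem_explSet.2 ha)) L _
  have hcp : ∀ θ, c ≤ p (sig θ) := fun θ => (hp θ).symm ▸ hL θ
  let r : JA A → ℝ := P₀ 0 []
  -- The acceptance probability that makes the overall chance of using `x` equal to `c`.
  let w : AIVal A → ℝ := fun s => if ∃ θ, s = sig θ then c / p s else 0
  have hw : ∀ s, 0 ≤ w s ∧ w s ≤ 1 := by
    intro s
    simp only [w]
    split_ifs with hs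
    · obtain ⟨θ, rfl⟩ := hs
      have := hc0.trans_le (hcp θ)
      exact ⟨by positivity, (div_le_one this).2 (hcp θ)⟩
    · exact ⟨le_rfl, zero_le_one⟩
  let F : Hist A → JA A → ℝ := fun h a =>
    w (observed h) * x a (observed h) + (1 - w (observed h)) * r a
  have hr := hP₀.1 0 []
  let Q := probeThen P L F r
  have hQlt : ∀ t < L, Q t = P t := fun t ht => funext fun h => if_pos ht
  have hQL : ∀ h, Q L h = F h := fun h => by simp [Q, probeThen]
  have hQgt : ∀ t, L < t → ∀ h, Q t h = r := fun t ht h => by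
    simp [Q, probeThen, ht.not_gt, ht.ne']
  have hQpol : IsPolicy Q := by
    intro t h
    rcases lt_trichotomy t L with ht | rfl | ht
    · rw [hQlt t ht]
      exact hP.1 t h
    · rw [hQL]
      have := hw (observed h)
      refine ⟨fun a => add_nonneg (mul_nonneg this.1 (hx.1.1 _ _))
        (mul_nonneg (by linarith) (hr.1 a)), ?_⟩
      simp only [F, Finset.sum_add_distrib, ← Finset.mul_sum, hx.1.2]
      rw [show ∑ a, r a = 1 from hr.2]
      ring
    · rw [hQgt t ht]
      exact hr
  have hround : ∀ g, roundExp ψ P₀ (detD f u) 0 g = ∑ θ, ψ θ * ∑ a, r a * g a θ := by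
    intro g
    simp only [roundExp_detD, expect_zero, r]
  have hval : ∀ g, roundExp ψ Q (detD f u) L g =
      c * recExp ψ B f u x g + (1 - c) * roundExp ψ P₀ (detD f u) 0 g := by
    intro g
    rw [hround, roundExp_detD, recExp, Finset.mul_sum, Finset.mul_sum,
      ← Finset.sum_add_distrib]
    refine Finset.sum_congr rfl fun θ _ => ?_
    set X := ∑ a, x a (allInfoVal B f u θ) * g a θ with hX
    set R := ∑ a, r a * g a θ with hR
    have hE : expect Q (table f u θ) L (fun h => ∑ a, Q L h a * g a θ)
        = expect P (table f u θ) L (fun h =>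
          (if observed h = sig θ then 1 else 0) * (c / p (sig θ) * (X - R)) + R) := by
      rw [expect_congr_policy _ hQlt]
      refine expect_congr hP.1 fun h _ hh => ?_
      have hF : ∑ a, Q L h a * g a θ
          = w (observed h) * ∑ a, x a (observed h) * g a θ + (1 - w (observed h)) * R := by
        simp only [hQL, F, add_mul, Finset.sum_add_distrib, mul_assoc, Finset.mul_sum, hR]
      rw [hF]
      by_cases hs : observed h = sig θ
      · rw [hs, if_pos rfl, show w (sig θ) = c / p (sig θ) from if_pos ⟨θ, rfl⟩]
        simp only [sig, ← hX]
        ring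
      · have : w (observed h) = 0 :=
          if_neg fun ⟨θ', hθ'⟩ => hs (allInfoVal_eq_of_observed_eq hP hh hθ')
        rw [this, if_neg hs]
        ring
    rw [hE, expect_add, expect_mul_const, expect_const hP.1, ← hp]
    have := (hc0.trans_le (hcp θ)).ne'
    field_simp
    ring
  refine ⟨Q, (isBIC_zero_iff ..).2 ⟨hQpol, fun t i ai ai' => ?_⟩, L, hval f⟩
  rw [isBIC_zero_iff] at hP hP₀
  rcases lt_trichotomy t L with ht | rfl | ht
  · convert hP.2 t i ai ai' using 1
    simp only [roundExp_detD, hQlt t ht,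
      expect_congr_policy _ fun s hs => hQlt s (lt_trans hs ht)]
  · rw [hval]
    exact add_nonneg (mul_nonneg hc0.le (hx.2 i ai ai'))
      (mul_nonneg (by linarith) (hP₀.2 0 i ai ai'))
  · have := hP₀.2 0 i ai ai'
    rw [hround] at this
    simpa only [roundExp_detD, hQgt t ht, expect_const hQpol] using this

end BestReward

/-- characterization of the deterministic benchmark. For Bayesian
Exploration with deterministic utilities, the one-round optimum over all BIC
iterative recommendation policies equals the optimal expected reward of a BIC
recommendation policy given the signal `AllInfo(A^det_{θ*})` consisting of the
utilities of all eventually-explorable joint actions. -/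
theorem deterministic_benchmark_characterization
    {n : ℕ} {Θ : Type} {A : Fin n → Type} [Fintype Θ] [∀ i, Fintype (A i)]
    (ψ : Θ → ℝ) (f : JA A → Θ → ℝ) (u : (i : Fin n) → JA A → Θ → ℝ)
    (hψ : IsPrior ψ) (hu : IsUtil f u) :
    OPT ψ (detD f u) f (fun P => IsBIC ψ P (detD f u) u 0)
      = REWstar ψ (qAI (explSet ψ (detD f u) u 0) f u) f u 0 := by
  have hsub : {r : ℝ | ∃ P, IsBIC ψ P (detD f u) u 0 ∧ ∃ t : ℕ, r = roundExp ψ P (detD f u) t f}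
      ⊆ {r : ℝ | ∃ x, InBIC ψ (qAI (explSet ψ (detD f u) u 0) f u) u 0 x ∧
          r = recREW ψ (qAI (explSet ψ (detD f u) u 0) f u) f x} := by
    rintro _ ⟨P, hP, t, rfl⟩
    obtain ⟨x, hx, hxf⟩ := exists_inBIC_recExp_eq hP t
    exact ⟨x, hx, by rw [recREW_qAI, hxf]⟩
  have hIcc : ∀ r ∈ {r : ℝ | ∃ x, InBIC ψ (qAI (explSet ψ (detD f u) u 0) f u) u 0 x ∧
      r = recREW ψ (qAI (explSet ψ (detD f u) u 0) f u) f x}, r ∈ Set.Icc (0:ℝ) 1 := by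
    rintro _ ⟨x, hx, rfl⟩
    rw [recREW_qAI]
    exact recExp_mem_Icc hψ hu _ hx.1
  have hbdd : BddAbove _ := ⟨1, fun r hr => (hIcc r hr).2⟩
  apply le_antisymm
  · exact Real.sSup_le (fun r hr => le_csSup hbdd (hsub hr))
      (Real.sSup_nonneg fun r hr => (hIcc r hr).1)
  · refine Real.sSup_le (fun r hr => ?_) (Real.sSup_nonneg fun r hr => (hIcc r (hsub hr)).1)
    have hr01 := hIcc r hr
    obtain ⟨x, hx, rfl⟩ := hr
    rw [recREW_qAI] at hr01 ⊢
    obtain ⟨P₀, hP₀⟩ := exists_isBIC_of_inBIC hx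
    have hr₀ := (hIcc _ (hsub ⟨P₀, hP₀, 0, rfl⟩)).1
    refine le_of_forall_pos_lt_add fun ε hε => ?_
    obtain ⟨δ, hδ0, hδ⟩ := exists_between (lt_min hε one_pos)
    obtain ⟨hδε, hδ1⟩ := lt_min_iff.1 hδ
    obtain ⟨P, hP, t, ht⟩ := exists_isBIC_roundExp_eq hP₀ hx (sub_pos.2 hδ1)
      (sub_lt_self 1 hδ0)
    have hle := le_csSup (hbdd.mono hsub) ⟨P, hP, t, rfl⟩
    rw [ht] at hle
    have h1 := mul_le_of_le_one_right hδ0.le hr01.2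
    have h2 : 0 ≤ (1 - (1 - δ)) * roundExp ψ P₀ (detD f u) 0 f :=
      mul_nonneg (by linarith) hr₀
    have h3 : (1 - δ) * recExp ψ (explSet ψ (detD f u) u 0) f u x f
        + (1 - (1 - δ)) * roundExp ψ P₀ (detD f u) 0 f
        ≤ OPT ψ (detD f u) f (fun P => IsBIC ψ P (detD f u) u 0) := hle
    change _ < OPT ψ (detD f u) f (fun P => IsBIC ψ P (detD f u) u 0) + ε
    linarith

end BE

end
end
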